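/- For every n ≥ 2, the code B_n of Construction 3 is a cyclic 1-skew-tolerant binary Gray code of length N = 2n+1 and size (7/12)·2^N − 8/3: all codewords are distinct, cyclically consecutive codewords differ in exactly one coordinate, and cyclically consecutive transition positions differ by exactly 1. -/

import Mathlib

/-- Codewords `c` and `d` differ exactly at coordinate `i` (1-based), by `±1` there. -/
def TransAt {m : ℕ} (c d : List (ZMod m)) (i : ℕ) : Prop :=
  1 ≤ i ∧ i ≤ c.length ∧ c.length = d.length ∧
  c.take (i-1) = d.take (i-1) ∧ c.drop i = d.drop i ∧
  (d.getD (i-1) 0 = c.getD (i-1) 0 + 1 ∨ d.getD (i-1) 0 = c.getD (i-1) 0 - 1)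

/-- Cyclic Gray code whose transition positions `δ` are integers;
position `p ∈ ℤ` corresponds to 1-based coordinate `p + o`. -/
def CyclicGrayZ {m : ℕ} (C : List (List (ZMod m))) (o : ℕ) (δ : ℕ → ℤ) : Prop :=
  C.Nodup ∧ ∀ i < C.length, ∃ j : ℕ, (j : ℤ) = δ i + o ∧
    TransAt (C.getD i []) (C.getD ((i+1) % C.length) []) j

/-- Non-cyclic Gray code with integer transition positions, offset `o`. -/
def PathGrayZ {m : ℕ} (C : List (List (ZMod m))) (o : ℕ) (δ : ℕ → ℤ) : Prop :=
  C.Nodup ∧ ∀ i, i + 1 < C.length → ∃ j : ℕ, (j : ℤ) = δ i + o ∧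
    TransAt (C.getD i []) (C.getD (i+1) []) j

/-- `B_{n+1}` from `A_n` in Construction 3: the all-zero word followed by the four blocks
`(0,A_n,1)`, `(1,reverse A_n,1)`, `(1,A_n,0)`, `(0, reverse of A_n minus first word ,0)`. -/
def buildB3 (An : List (List (ZMod 2))) (len : ℕ) : List (List (ZMod 2)) :=
  List.replicate len (0 : ZMod 2) ::
    (An.map (fun c => 0 :: c ++ [1]) ++ An.reverse.map (fun c => 1 :: c ++ [1]) ++
     An.map (fun c => 1 :: c ++ [0]) ++ An.tail.reverse.map (fun c => 0 :: c ++ [0]))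

/-- The words `Σ_{i=1}^{j} e_{-i} + Σ_{i=1}^{n} e_i`, `j = 1, …, n+1`,
as lists of length `2n+3` (positions `-(n+1), …, n+1`). -/
def newWords (n : ℕ) : List (List (ZMod 2)) :=
  (List.range (n+1)).map (fun j =>
    List.replicate (n-j) (0 : ZMod 2) ++ List.replicate (j+1) 1 ++ [0] ++
      List.replicate n 1 ++ [0])

/-- Construction 3, codes `A_n` (length `2n+1`, positions `-n, …, n`). -/
def c3A : ℕ → List (List (ZMod 2))
  | 0 => []
  | 1 => [[0,0,0],[0,0,1],[0,1,1],[1,1,1]]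
  | (n+2) =>
    let B := buildB3 (c3A (n+1)) (2*n+5)
    B.take (B.length - n) ++ newWords (n+1)

/-- Construction 3, codes `B_n` (length `2n+1`). -/
def c3B : ℕ → List (List (ZMod 2))
  | 0 => []
  | (n+1) => buildB3 (c3A n) (2*n+3)

/-- `d` is obtained from the binary word `c` by flipping position `p`, which is the 1-based
coordinate `p + o`. -/
def Flip (o : ℕ) (p : ℤ) (c d : List (ZMod 2)) : Prop :=
  ∃ l x r, c = l ++ x :: r ∧ d = l ++ (x + 1) :: r ∧ (l.length : ℤ) + 1 = p + o

/-- `SkewWalk o c d C p q`: the list `C` has at least two words, starts at `c`, ends at `d`,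
consecutive words differ by one flip, consecutive flip positions differ by one, and the first and
last flip positions are `p` and `q`. -/
inductive SkewWalk (o : ℕ) :
    List (ZMod 2) → List (ZMod 2) → List (List (ZMod 2)) → ℤ → ℤ → Prop
  | edge {c d p} : Flip o p c d → SkewWalk o c d [c, d] p p
  | cons {c c' d C s p q} : Flip o s c c' → |s - p| = 1 → SkewWalk o c' d C p q →
      SkewWalk o c d (c :: C) s q

/-- The word `c` with the letter `a` prepended and the letter `b` appended. -/
def frame (a b : ZMod 2) (c : List (ZMod 2)) : List (ZMod 2) := a :: c ++ [b]

/-- The word of length `L` consisting of zeros followed by `j` ones. -/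
def stair (L j : ℕ) : List (ZMod 2) := List.replicate (L - j) 0 ++ List.replicate j 1

theorem ZMod.two_add_one_add_one (x : ZMod 2) : x + 1 + 1 = x := by
  revert x; decide

theorem Flip.symm {o p c d} (h : Flip o p c d) : Flip o p d c := by
  obtain ⟨l, x, r, rfl, rfl, h⟩ := h
  exact ⟨l, x + 1, r, rfl, by rw [ZMod.two_add_one_add_one], h⟩

theorem Flip.frame {o p c d} (a b) (h : Flip o p c d) :
    Flip (o + 1) p (frame a b c) (frame a b d) := by
  obtain ⟨l, x, r, rfl, rfl, h⟩ := h
  refine ⟨a :: l, x, r ++ [b], by simp [_root_.frame], by simp [_root_.frame], ?_⟩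
  push_cast [List.length_cons]; linarith

theorem Flip.frame_left (c : List (ZMod 2)) (a b) {o : ℕ} {p : ℤ} (h : p + o = 1) :
    Flip o p (_root_.frame a b c) (_root_.frame (a + 1) b c) :=
  ⟨[], a, c ++ [b], rfl, rfl, by simp [h]⟩

theorem Flip.frame_right (c : List (ZMod 2)) (a b) {o : ℕ} {p : ℤ} (h : p + o = c.length + 2) :
    Flip o p (_root_.frame a b c) (_root_.frame a (b + 1) c) :=
  ⟨a :: c, b, [], rfl, rfl, by push_cast [List.length_cons]; linarith⟩

theorem Flip.length_eq {o p c d} (h : Flip o p c d) : c.length = d.length := by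
  obtain ⟨l, x, r, rfl, rfl, h⟩ := h
  simp

theorem Flip.transAt {o p c d} (h : Flip o p c d) :
    ∃ j : ℕ, (j : ℤ) = p + o ∧ TransAt c d j := by
  obtain ⟨l, x, r, rfl, rfl, h⟩ := h
  refine ⟨l.length + 1, by push_cast; exact h, ?_⟩
  simp [TransAt]

namespace SkewWalk

variable {o : ℕ} {c d c' d' : List (ZMod 2)} {C C' : List (List (ZMod 2))} {p q p' q' s : ℤ}

theorem join (h : SkewWalk o c d C p q) (hs : Flip o s d c') (hq : |q - s| = 1)
    (hp : |s - p'| = 1) (h' : SkewWalk o c' d' C' p' q') : SkewWalk o c d' (C ++ C') p q' := by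
  induction h with
  | edge hf => exact cons hf hq (cons hs hp h')
  | cons hf hsp _ ih => exact cons hf hsp (ih hs hq)

theorem snoc (h : SkewWalk o c d C p q) (hs : Flip o s d c') (hq : |q - s| = 1) :
    SkewWalk o c c' (C ++ [c']) p s := by
  induction h with
  | edge hf => exact cons hf hq (edge hs)
  | cons hf hsp _ ih => exact cons hf hsp (ih hs hq)

theorem reverse (h : SkewWalk o c d C p q) : SkewWalk o d c C.reverse q p := by
  induction h with
  | edge hf => exact edge hf.symm
  | cons hf hsp _ ih =>
    rw [List.reverse_cons]
    exact ih.snoc hf.symm (by rw [abs_sub_comm]; exact hsp)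

theorem map_frame (a b : ZMod 2) (h : SkewWalk o c d C p q) :
    SkewWalk (o + 1) (frame a b c) (frame a b d) (C.map (frame a b)) p q := by
  induction h with
  | edge hf => exact edge (hf.frame a b)
  | cons hf hsp _ ih => exact cons (hf.frame a b) hsp ih

theorem range_append {f : ℕ → List (ZMod 2)} {g : ℕ → ℤ} (m : ℕ)
    (hf : ∀ j < m, Flip o (g j) (f j) (f (j + 1))) (hg : ∀ j, |g j - g (j + 1)| = 1)
    (h : SkewWalk o (f m) d C (g m) q) :
    SkewWalk o (f 0) d ((List.range m).map f ++ C) (g 0) q := by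
  induction m generalizing C with
  | zero => simpa using h
  | succ m ih =>
    rw [List.range_succ, List.map_append, List.append_assoc]
    exact ih (fun j hj => hf j (by omega)) (cons (hf m (by omega)) (hg m) h)

theorem eq_cons (h : SkewWalk o c d C p q) : ∃ T, C = c :: T := by
  cases h <;> exact ⟨_, rfl⟩

theorem length_eq (h : SkewWalk o c d C p q) : c.length = d.length := by
  induction h with
  | edge hf => exact hf.length_eq
  | cons hf _ _ ih => exact hf.length_eq.trans ih

theorem exists_positions (h : SkewWalk o c d C p q) : ∃ δ : ℕ → ℤ, ∃ m, C.length = m + 2 ∧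
    δ 0 = p ∧ δ m = q ∧ (∀ i ≤ m, Flip o (δ i) (C.getD i []) (C.getD (i + 1) [])) ∧
    ∀ i < m, |δ i - δ (i + 1)| = 1 := by
  induction h with
  | @edge c d p hf => exact ⟨fun _ => p, 0, by simp, rfl, rfl, by simpa using hf, by simp⟩
  | @cons c c' d C s p q hf hsp hw ih =>
    obtain ⟨δ, m, hm, h0, hq, hF, hS⟩ := ih
    obtain ⟨T, rfl⟩ := hw.eq_cons
    refine ⟨fun i => i.casesOn s δ, m + 1, by simpa using hm, rfl, hq, ?_, ?_⟩
    · rintro (_ | i) hi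
      · simpa using hf
      · exact hF i (by omega)
    · rintro (_ | i) hi
      · simpa [h0] using hsp
      · exact hS i (by omega)

theorem cyclicGrayZ (h : SkewWalk o c c (C ++ [c]) p q) (hC : C.Nodup) (hpq : |q - p| = 1) :
    ∃ δ : ℕ → ℤ, CyclicGrayZ C o δ ∧
      ∀ i < C.length, |δ i - δ ((i + 1) % C.length)| = 1 := by
  obtain ⟨δ, m, hm, h0, hq, hF, hS⟩ := h.exists_positions
  obtain ⟨T, hT⟩ := h.eq_cons
  have hl : C.length = m + 1 := by simpa using hm
  have hc : C.getD 0 [] = c := by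
    cases C with
    | nil => simp at hl
    | cons x C => exact (List.cons.inj hT).1
  refine ⟨δ, ⟨hC, fun i hi => ?_⟩, fun i hi => ?_⟩
  · have hf := hF i (by omega)
    rw [List.getD_append _ _ _ _ hi] at hf
    apply Flip.transAt
    rcases Nat.lt_or_ge (i + 1) C.length with h1 | h1
    · rwa [List.getD_append _ _ _ _ h1, ← Nat.mod_eq_of_lt h1] at hf
    · have h2 : i + 1 = C.length := by omega
      rw [h2, Nat.mod_self, hc]
      rw [List.getD_append_right _ _ _ _ h1, h2] at hf
      simpa using hf
  · rcases Nat.lt_or_ge (i + 1) C.length with h1 | h1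
    · rw [Nat.mod_eq_of_lt h1]
      exact hS i (by omega)
    · have h2 : i = m := by omega
      rw [h2, ← hl, Nat.mod_self, h0, hq]
      exact hpq

end SkewWalk

theorem frame_inj {a b a' b' : ZMod 2} {c c' : List (ZMod 2)} :
    frame a b c = frame a' b' c' ↔ a = a' ∧ b = b' ∧ c = c' := by
  simp only [frame, List.cons_append, List.cons.injEq, List.append_singleton_inj]
  tauto

theorem frame_injective (a b : ZMod 2) : Function.Injective (frame a b) :=
  fun _ _ h => (frame_inj.1 h).2.2

theorem length_frame (a b : ZMod 2) (c : List (ZMod 2)) :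
    (frame a b c).length = c.length + 2 := by
  simp [frame]

theorem stair_zero (L : ℕ) : stair L 0 = List.replicate L 0 := by
  simp [stair]

theorem frame_stair {L j : ℕ} (h : j ≤ L) : frame 0 1 (stair L j) = stair (L + 2) (j + 1) := by
  rw [stair, stair, show L + 2 - (j + 1) = L - j + 1 by omega, List.replicate_succ,
    List.replicate_succ' (n := j)]
  simp [frame]

theorem frame_stair_zero (L : ℕ) : frame 0 0 (stair L 0) = stair (L + 2) 0 := by
  rw [stair_zero, stair_zero, List.replicate_succ, List.replicate_succ']
  simp [frame]

theorem flip_stair {L j o : ℕ} {p : ℤ} (h : j < L) (hp : p + o = L - j) :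
    Flip o p (stair L j) (stair L (j + 1)) := by
  obtain ⟨k, rfl⟩ := Nat.exists_eq_add_of_lt h
  refine ⟨List.replicate k 0, 0, List.replicate j 1, ?_, ?_, ?_⟩
  · rw [stair, show j + k + 1 - j = k + 1 by omega, List.replicate_succ']
    simp
  · rw [stair, show j + k + 1 - (j + 1) = k by omega, List.replicate_succ]
    simp
  · rw [hp]; push_cast [List.length_replicate]; ring

theorem buildB3_eq (A : List (List (ZMod 2))) (L : ℕ) : buildB3 A L =
    List.replicate L 0 :: (A.map (frame 0 1) ++ A.reverse.map (frame 1 1) ++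
      A.map (frame 1 0) ++ A.tail.reverse.map (frame 0 0)) := rfl

theorem length_buildB3 {A : List (List (ZMod 2))} (hA : A ≠ []) (L : ℕ) :
    (buildB3 A L).length = 4 * A.length := by
  have := List.length_pos_of_ne_nil hA
  simp [buildB3_eq]
  omega

theorem mem_buildB3_frame {A : List (List (ZMod 2))} {L : ℕ} {a b : ZMod 2} {c}
    (h0 : stair L 0 ∈ A) (h : frame a b c ∈ buildB3 A (L + 2)) : c ∈ A := by
  rw [buildB3_eq, ← stair_zero, ← frame_stair_zero] at h
  simp only [List.mem_cons, List.mem_append, List.mem_map, List.mem_reverse, frame_inj] at h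
  rcases h with h | ((⟨x, hx, h⟩ | ⟨x, hx, h⟩) | ⟨x, hx, h⟩) | ⟨x, hx, h⟩
  · rwa [h.2.2]
  · rwa [← h.2.2]
  · rwa [← h.2.2]
  · rwa [← h.2.2]
  · rw [← h.2.2]; exact List.mem_of_mem_tail hx

theorem length_of_mem_buildB3 {A : List (List (ZMod 2))} {L : ℕ}
    (hA : ∀ c ∈ A, c.length = L) : ∀ c ∈ buildB3 A (L + 2), c.length = L + 2 := by
  intro c h
  rw [buildB3_eq] at h
  simp only [List.mem_cons, List.mem_append, List.mem_map, List.mem_reverse] at h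
  rcases h with rfl | ((⟨x, hx, rfl⟩ | ⟨x, hx, rfl⟩) | ⟨x, hx, rfl⟩) | ⟨x, hx, rfl⟩
  · simp
  · rw [length_frame, hA x hx]
  · rw [length_frame, hA x hx]
  · rw [length_frame, hA x hx]
  · rw [length_frame, hA x (List.mem_of_mem_tail hx)]

theorem nodup_buildB3 {T : List (List (ZMod 2))} {L : ℕ} (h : (stair L 0 :: T).Nodup) :
    (buildB3 (stair L 0 :: T) (L + 2)).Nodup := by
  have hT := List.nodup_cons.1 h
  rw [buildB3_eq, ← stair_zero, ← frame_stair_zero, List.nodup_cons]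
  refine ⟨?_, ?_⟩
  · simp only [List.mem_append, List.mem_map, List.mem_reverse, List.tail_cons, frame_inj]
    rintro (((⟨x, hx, h⟩ | ⟨x, hx, h⟩) | ⟨x, hx, h⟩) | ⟨x, hx, h⟩)
    · exact absurd h.2.1 (by decide)
    · exact absurd h.1 (by decide)
    · exact absurd h.1 (by decide)
    · exact hT.1 (h.2.2 ▸ hx)
  · have key {a b a' b' : ZMod 2} (hab : (a, b) ≠ (a', b')) {X Y : List (List (ZMod 2))} :
        List.Disjoint (X.map (frame a b)) (Y.map (frame a' b')) := by
      intro c hX hY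
      obtain ⟨x, -, rfl⟩ := List.mem_map.1 hX
      obtain ⟨y, -, hy⟩ := List.mem_map.1 hY
      have := frame_inj.1 hy
      exact hab (by rw [this.1, this.2.1])
    refine List.Nodup.append (List.Nodup.append (List.Nodup.append ?_ ?_ ?_) ?_ ?_) ?_ ?_
    · exact h.map (frame_injective _ _)
    · exact (List.nodup_reverse.2 h).map (frame_injective _ _)
    · exact key (by decide)
    · exact h.map (frame_injective _ _)
    · exact List.disjoint_append_left.2 ⟨key (by decide), key (by decide)⟩
    · exact (List.nodup_reverse.2 hT.2).map (frame_injective _ _)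
    · exact List.disjoint_append_left.2
        ⟨List.disjoint_append_left.2 ⟨key (by decide), key (by decide)⟩, key (by decide)⟩

/-- The word of `newWords n` with `j + 1` consecutive ones in the negative positions. -/
def newWord (n j : ℕ) : List (ZMod 2) :=
  List.replicate (n - j) 0 ++ List.replicate (j + 1) 1 ++ [0] ++ List.replicate n 1 ++ [0]

/-- The word of length `2n+1` with `j` ones in the negative positions, next to the zero at the
centre, and ones in all positive positions. -/
def gapWord (n j : ℕ) : List (ZMod 2) :=
  List.replicate (n - j) 0 ++ List.replicate j 1 ++ [0] ++ List.replicate n 1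

theorem newWords_eq (n : ℕ) : newWords n = (List.range (n + 1)).map (newWord n) := rfl

theorem newWord_eq_frame_of_lt {n j : ℕ} (h : j < n) :
    newWord n j = frame 0 0 (gapWord n (j + 1)) := by
  rw [newWord, gapWord, show n - j = (n - (j + 1)) + 1 by omega, List.replicate_succ]
  simp [frame]

theorem newWord_self (n : ℕ) : newWord n n = frame 1 0 (gapWord n n) := by
  simp [newWord, gapWord, frame, List.replicate_succ]

theorem gapWord_succ_eq_frame {n j : ℕ} (h : j ≤ n) :
    gapWord (n + 1) j = frame 0 1 (gapWord n j) := by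
  rw [gapWord, gapWord, show n + 1 - j = (n - j) + 1 by omega, List.replicate_succ,
    List.replicate_succ' (n := n)]
  simp [frame]

theorem gapWord_succ_self (n : ℕ) : gapWord (n + 1) (n + 1) = frame 1 1 (gapWord n n) := by
  have h : List.replicate (n + 1) (1 : ZMod 2) ++ [0] ++ List.replicate (n + 1) 1 =
      1 :: List.replicate n 1 ++ [0] ++ (List.replicate n 1 ++ [1]) := by
    rw [← List.replicate_succ, ← List.replicate_succ']
  simpa [gapWord, frame] using h

theorem length_newWord {n j : ℕ} (h : j ≤ n) : (newWord n j).length = 2 * n + 3 := by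
  simp [newWord]; omega

theorem flip_newWord {n j : ℕ} (h : j < n) :
    Flip (n + 2) (-2 - j) (newWord n j) (newWord n (j + 1)) := by
  refine ⟨List.replicate (n - (j + 1)) 0, 0,
    List.replicate (j + 1) 1 ++ [0] ++ List.replicate n 1 ++ [0], ?_, ?_, ?_⟩
  · rw [newWord, show n - j = (n - (j + 1)) + 1 by omega, List.replicate_succ']
    simp
  · rw [newWord, List.replicate_succ (n := j + 1)]
    simp
  · rw [List.length_replicate]; push_cast [Nat.cast_sub (show j + 1 ≤ n from h)]; ring

theorem flip_stair_newWord (n : ℕ) :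
    Flip (n + 2) (-1) (frame 0 0 (stair (2 * n + 1) n)) (newWord n 0) := by
  refine ⟨List.replicate n 0, 0, 0 :: List.replicate n 1 ++ [0], ?_, ?_, ?_⟩
  · rw [stair, show 2 * n + 1 - n = n + 1 by omega, frame, ← List.cons_append,
      ← List.replicate_succ, List.replicate_succ' (n := n + 1), List.replicate_succ' (n := n)]
    simp
  · simp [newWord]
  · rw [List.length_replicate]; push_cast; ring

theorem nodup_newWords (n : ℕ) : (newWords n).Nodup := by
  rw [newWords_eq]
  refine List.Nodup.map_on ?_ List.nodup_range
  intro i hi j hj h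
  have hs : ∀ k ≤ n, (newWord n k).count 1 = k + 1 + n := by
    intro k _
    simp [newWord, List.count_replicate]
  have := congrArg (List.count 1) h
  rw [List.mem_range] at hi hj
  rw [hs i (by omega), hs j (by omega)] at this
  omega

theorem skewWalk_newWords {n : ℕ} (hn : 1 ≤ n) :
    SkewWalk (n + 2) (newWord n 0) (newWord n n) (newWords n) (-2) (-n - 1) := by
  obtain ⟨m, rfl⟩ := Nat.exists_eq_add_of_le' hn
  rw [newWords_eq, List.range_succ, List.range_succ, List.append_assoc, List.map_append]
  have h := SkewWalk.range_append (f := newWord (m + 1)) (g := fun j => -2 - (j : ℤ)) m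
    (fun j hj => flip_newWord (by omega)) (fun j => by push_cast; ring_nf; simp)
    (SkewWalk.edge (flip_newWord (Nat.lt_succ_self m)))
  convert h using 1
  · simp
  · simp
  · push_cast; ring

/-- The properties of the code `A_n` that are carried through the recursion. -/
structure GoodCode (n : ℕ) (A : List (List (ZMod 2))) : Prop where
  nodup : A.Nodup
  length_mem : ∀ c ∈ A, c.length = 2 * n + 1
  card : 6 * A.length + 4 = 7 * 4 ^ n
  gapWord_notMem : ∀ j, 1 ≤ j → j ≤ n → gapWord n j ∉ A
  walk : ∃ R z, A = (List.range n).map (stair (2 * n + 1)) ++ R ∧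
    SkewWalk (n + 1) (stair (2 * n + 1) n) z R 0 (-n)

theorem skewWalk_stair_append {n : ℕ} {R z}
    (h : SkewWalk (n + 1) (stair (2 * n + 1) n) z R 0 (-n)) :
    SkewWalk (n + 1) (stair (2 * n + 1) 0) z
      ((List.range n).map (stair (2 * n + 1)) ++ R) n (-n) := by
  have := SkewWalk.range_append (o := n + 1) (f := stair (2 * n + 1)) (g := fun j => (n : ℤ) - j)
    (d := z) (C := R) (q := -n) n
    (fun j hj => flip_stair (by omega) (by push_cast; ring)) (fun j => by push_cast; ring_nf; simp)
    (by simpa using h)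
  simpa using this

theorem GoodCode.skewWalk {n A} (h : GoodCode n A) :
    ∃ z, SkewWalk (n + 1) (stair (2 * n + 1) 0) z A n (-n) := by
  obtain ⟨R, z, rfl, hR⟩ := h.walk
  exact ⟨z, skewWalk_stair_append hR⟩

theorem SkewWalk.blocks {n : ℕ} {A R z w} {p : ℤ}
    (hA : SkewWalk (n + 1) (stair (2 * n + 1) 0) z A n (-n))
    {B} (hB : SkewWalk (n + 1) w z B p (-n))
    (hR : SkewWalk (n + 1) w z R p (-n)) :
    SkewWalk (n + 2) (frame 0 1 w) (frame 0 0 w)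
      (B.map (frame 0 1) ++ A.reverse.map (frame 1 1) ++ A.map (frame 1 0) ++
        R.reverse.map (frame 0 0)) p p := by
  have hz : z.length = 2 * n + 1 := by
    rw [← hA.length_eq, stair_zero, List.length_replicate]
  refine SkewWalk.join (s := -n - 1) (SkewWalk.join (s := n + 1) (SkewWalk.join (s := -n - 1)
    (hB.map_frame 0 1) ?_ ?_ ?_ (hA.reverse.map_frame 1 1)) ?_ ?_ ?_ (hA.map_frame 1 0)) ?_ ?_ ?_
    (hR.reverse.map_frame 0 0)
  · exact Flip.frame_left z 0 1 (by push_cast; ring)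
  · ring_nf; simp
  · ring_nf; simp
  · exact Flip.frame_right _ 1 1
      (by rw [stair_zero, List.length_replicate]; push_cast; ring)
  · ring_nf; simp
  · ring_nf; simp
  · exact Flip.frame_left z 1 0 (by push_cast; ring)
  · ring_nf; simp
  · ring_nf; simp

theorem goodCode_one : GoodCode 1 (c3A 1) where
  nodup := by decide
  length_mem := by decide
  card := by decide
  gapWord_notMem := by
    intro j h1 h2
    obtain rfl : j = 1 := by omega
    decide
  walk := by
    refine ⟨[[0,0,1],[0,1,1],[1,1,1]], [1,1,1], by decide, ?_⟩
    exact SkewWalk.cons (p := -1) ⟨[0], 0, [1], by decide, by decide, by simp⟩ (by simp)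
      (SkewWalk.edge ⟨[], 0, [1, 1], by decide, by decide, by simp⟩)

theorem GoodCode.stair_zero_mem {n A} (h : GoodCode n A) : stair (2 * n + 1) 0 ∈ A := by
  obtain ⟨z, hz⟩ := h.skewWalk
  obtain ⟨T, hT⟩ := hz.eq_cons
  simp [hT]

theorem GoodCode.nodup_buildB3 {n A} (h : GoodCode n A) : (buildB3 A (2 * n + 3)).Nodup := by
  obtain ⟨z, hz⟩ := h.skewWalk
  obtain ⟨T, rfl⟩ := hz.eq_cons
  exact _root_.nodup_buildB3 h.nodup

theorem GoodCode.length_buildB3 {n A} (h : GoodCode n A) (L : ℕ) :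
    (buildB3 A L).length = 4 * A.length :=
  _root_.length_buildB3 (List.ne_nil_of_mem h.stair_zero_mem) L

theorem GoodCode.succ {n A} (hn : 1 ≤ n) (h : GoodCode n A) :
    GoodCode (n + 1)
      ((buildB3 A (2 * n + 3)).take ((buildB3 A (2 * n + 3)).length - (n - 1)) ++ newWords n) := by
  have hlen : n - 1 ≤ (buildB3 A (2 * n + 3)).length := by
    obtain ⟨R, z, rfl, -⟩ := h.walk
    rw [h.length_buildB3]
    simp
    omega
  have new_notMem : ∀ c ∈ newWords n, c ∉ buildB3 A (2 * n + 3) := by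
    intro c hc hB
    obtain ⟨j, hj, rfl⟩ := List.mem_map.1 hc
    change newWord n j ∈ _ at hB
    rw [List.mem_range] at hj
    rcases Nat.lt_or_ge j n with hjn | hjn
    · rw [newWord_eq_frame_of_lt hjn] at hB
      exact h.gapWord_notMem (j + 1) (by omega) hjn (mem_buildB3_frame h.stair_zero_mem hB)
    · obtain rfl : j = n := by omega
      rw [newWord_self] at hB
      exact h.gapWord_notMem j hn le_rfl (mem_buildB3_frame h.stair_zero_mem hB)
  refine ⟨?_, ?_, ?_, ?_, ?_⟩
  · refine List.Nodup.append (h.nodup_buildB3.sublist (List.take_sublist _ _)) (nodup_newWords n) ?_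
    exact fun c hc hc' => new_notMem c hc' (List.mem_of_mem_take hc)
  · intro c hc
    rcases List.mem_append.1 hc with hc | hc
    · exact length_of_mem_buildB3 h.length_mem c (List.mem_of_mem_take hc)
    · obtain ⟨j, hj, rfl⟩ := List.mem_map.1 hc
      exact length_newWord (by rw [List.mem_range] at hj; omega)
  · have hc := h.card
    have hw : (newWords n).length = n + 1 := by simp [newWords_eq]
    have hB := h.length_buildB3 (2 * n + 3)
    rw [List.length_append, List.length_take, hw, pow_succ]
    omega
  · intro j h1 h2 hj
    rcases List.mem_append.1 hj with hj | hj
    · have hB := List.mem_of_mem_take hj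
      rcases Nat.lt_or_ge n j with hjn | hjn
      · obtain rfl : j = n + 1 := by omega
        rw [gapWord_succ_self] at hB
        exact h.gapWord_notMem n hn le_rfl (mem_buildB3_frame h.stair_zero_mem hB)
      · rw [gapWord_succ_eq_frame hjn] at hB
        exact h.gapWord_notMem j h1 hjn (mem_buildB3_frame h.stair_zero_mem hB)
    · obtain ⟨i, -, hi⟩ := List.mem_map.1 hj
      have := congrArg List.getLast? hi
      rw [gapWord, List.replicate_succ' (n := n), ← List.append_assoc,
        List.getLast?_concat, List.getLast?_concat] at this
      exact absurd this (by decide)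
  · obtain ⟨R, z, hA, hR⟩ := h.walk
    have hw : SkewWalk (n + 1) (stair (2 * n + 1) 0) z A n (-n) :=
      hA ▸ skewWalk_stair_append hR
    refine ⟨R.map (frame 0 1) ++ A.reverse.map (frame 1 1) ++
      A.map (frame 1 0) ++ R.reverse.map (frame 0 0) ++ newWords n, newWord n n, ?_, ?_⟩
    · rw [h.length_buildB3, ← List.append_assoc]
      congr 1
      have hlen : A.length = n + R.length := by simp [hA]
      have htail : A.tail.reverse =
          R.reverse ++ ((List.range n).map (stair (2 * n + 1))).tail.reverse := by
        rw [hA, List.tail_append_of_ne_nil (by simp; omega), List.reverse_append]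
      have hfront : (List.range (n + 1)).map (stair (2 * (n + 1) + 1)) =
          List.replicate (2 * n + 3) 0 ::
            ((List.range n).map (stair (2 * n + 1))).map (frame 0 1) := by
        rw [List.range_succ_eq_map, List.map_cons, List.map_map, List.map_map, stair_zero]
        refine congrArg _ (List.map_congr_left fun j hj => ?_)
        rw [List.mem_range] at hj
        exact (frame_stair (L := 2 * n + 1) (j := j) (by omega)).symm
      have hA' : A.map (frame 0 1) = ((List.range n).map (stair (2 * n + 1))).map (frame 0 1) ++
          R.map (frame 0 1) := by
        rw [← List.map_append, ← hA]
      rw [buildB3_eq, htail, hfront, hA', List.map_append]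
      simp only [← List.append_assoc, ← List.cons_append]
      refine List.take_left' ?_
      simp [hlen]
      omega
    · have := (hw.blocks hR hR).join (s := -1) (flip_stair_newWord n) (by simp) (by simp)
        (skewWalk_newWords hn)
      rw [frame_stair (by omega)] at this
      rwa [show (-((n + 1 : ℕ) : ℤ)) = -n - 1 by push_cast; ring]

theorem goodCode_c3A {n : ℕ} (hn : 1 ≤ n) : GoodCode n (c3A n) := by
  induction n, hn using Nat.le_induction with
  | base => exact goodCode_one
  | succ n hn ih =>
    obtain ⟨m, rfl⟩ := Nat.exists_eq_add_of_le' hn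
    exact ih.succ hn

theorem GoodCode.skewWalk_buildB3 {n A} (h : GoodCode n A) :
    SkewWalk (n + 2) (stair (2 * n + 3) 0) (stair (2 * n + 3) 0)
      (buildB3 A (2 * n + 3) ++ [stair (2 * n + 3) 0]) (n + 1) n := by
  obtain ⟨z, hz⟩ := h.skewWalk
  have hb := hz.blocks hz hz
  rw [frame_stair_zero, frame_stair (Nat.zero_le _)] at hb
  have := SkewWalk.cons (s := n + 1)
    (flip_stair (L := 2 * n + 3) (j := 0) (by omega) (by push_cast; ring)) (by simp) hb
  obtain ⟨T, rfl⟩ := hz.eq_cons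
  rw [buildB3_eq, ← stair_zero]
  simpa [frame_stair_zero] using this

theorem stmt8 : ∀ n : ℕ, 2 ≤ n →
    (∀ c ∈ c3B n, c.length = 2*n+1) ∧
    12 * ((c3B n).length : ℤ) = 7 * 2 ^ (2*n+1) - 32 ∧
    ∃ δ : ℕ → ℤ, CyclicGrayZ (c3B n) (n+1) δ ∧
      ∀ i < (c3B n).length, |δ i - δ ((i+1) % (c3B n).length)| = 1 := by
  intro n hn
  obtain ⟨n, rfl⟩ := Nat.exists_eq_add_of_le' (show 1 ≤ n by omega)
  have h := goodCode_c3A (show 1 ≤ n by omega)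
  refine ⟨length_of_mem_buildB3 h.length_mem, ?_,
    h.skewWalk_buildB3.cyclicGrayZ h.nodup_buildB3 (by simp)⟩
  have hB : (c3B (n + 1)).length = 4 * (c3A n).length := h.length_buildB3 _
  have hc : (6 * (c3A n).length + 4 : ℤ) = 7 * 4 ^ n := by exact_mod_cast h.card
  have hp : (2 : ℤ) ^ (2 * (n + 1) + 1) = 8 * 4 ^ n := by
    rw [show 2 * (n + 1) + 1 = 2 * n + 3 by ring, pow_add, pow_mul]; norm_num; ring
  rw [hB, hp]
  push_cast
  linarith
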